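/- Let T_0 ∈ (0, π) with 2π/T_0 ∉ ℕ, and set N := ⌊2π/T_0⌋ and j := ⌊π/T_0⌋. If both N and j are odd, then T_opt(T_0) = N·T_0 + π; in particular the set { t > 0 : μ((D(T_0,t))ᶜ) = 0 } is nonempty. -/

import Mathlib

open MeasureTheory Set Real Filter Topology

noncomputable section

instance : Fact (0 < 2 * Real.pi) := ⟨by positivity⟩

/-- λ_k: 0 for even k, π for odd k. -/
def lam (k : ℕ) : ℝ := if Even k then 0 else Real.pi

/-- Covered set D(T₀, t) ⊆ ℝ/(2πℤ): the union over k of the projections of the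
observation intervals (k·T₀, min((k+1)·T₀, t)) translated by −λ_k. -/
def coveredSet (T0 t : ℝ) : Set (AddCircle (2 * Real.pi)) :=
  ⋃ k : ℕ, (fun a : ℝ => ((a - lam k : ℝ) : AddCircle (2 * Real.pi))) ''
    Set.Ioo ((k : ℝ) * T0) (min (((k : ℝ) + 1) * T0) t)

/-- Optimal control time T_opt(T₀). -/
def Topt (T0 : ℝ) : ℝ :=
  sInf { t : ℝ | 0 < t ∧ volume (coveredSet T0 t)ᶜ = 0 }


theorem aux_lower (T t : ℝ) (j : ℕ) (hT : 0 < T) (hjo : Odd j)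
    (h1 : (2 * j + 1) * T < 2 * π) (h2 : 2 * π < (2 * j + 2) * T)
    (ht : t < (2 * j + 1) * T + π) (x : ℝ) (hx1 : j * T < x) (hx2 : t - 2 * π < x)
    (hx3 : x < (2 * j + 1) * T - π) :
    (x : AddCircle (2 * Real.pi)) ∉ coveredSet T t := by
  have hpi := Real.pi_pos
  have hjT : 0 ≤ (j : ℝ) * T := by positivity
  have key : ∀ (p q : ℕ) (y : ℝ), p * T < y → y < (p + 1) * T → q * T < y → y < (q + 1) * T →
      p = q := by
    intro p q y a b c d
    have e1 : (p : ℝ) < q + 1 := lt_of_mul_lt_mul_right (a.trans d) hT.le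
    have e2 : (q : ℝ) < p + 1 := lt_of_mul_lt_mul_right (c.trans b) hT.le
    have e3 : p < q + 1 := by exact_mod_cast e1
    have e4 : q < p + 1 := by exact_mod_cast e2
    omega
  intro hmem
  simp only [coveredSet, mem_iUnion, mem_image, mem_Ioo, lt_min_iff] at hmem
  obtain ⟨k, a, ⟨ha1, ha2, ha3⟩, hax⟩ := hmem
  have ha0 : 0 < a := lt_of_le_of_lt (by positivity) ha1
  rw [← sub_eq_zero, ← AddCircle.coe_sub, AddCircle.coe_eq_zero_iff] at hax
  obtain ⟨m, hm⟩ := hax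
  rw [zsmul_eq_mul] at hm
  have hm' : a = x + lam k + m * (2 * π) := by
    linarith
  have hlam0 : 0 ≤ lam k ∧ lam k ≤ π := by
    unfold lam; split_ifs <;> constructor <;> linarith
  have hm0 : m = 0 := by
    have u1 : m < 1 := by
      by_contra hc
      have : (1 : ℝ) ≤ m := by exact_mod_cast (not_lt.mp hc)
      nlinarith
    have u2 : -1 < m := by
      by_contra hc
      have : (m : ℝ) ≤ -1 := by exact_mod_cast (not_lt.mp hc)
      nlinarith
    omega
  subst hm0
  unfold lam at hm'
  split_ifs at hm' with hk
  · have := key k j a ha1 ha2 (by push_cast at hm'; linarith) (by push_cast at hm'; linarith)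
    subst this
    exact (Nat.not_even_iff_odd.mpr hjo) hk
  · have := key k (2 * j) a ha1 ha2 (by push_cast at *; linarith) (by push_cast at *; linarith)
    subst this
    exact hk (even_two_mul j)

theorem aux_upper (T : ℝ) (j : ℕ) (hT : 0 < T) (hjo : Odd j)
    (h0 : j * T ≤ π) (h0' : π < (j + 1) * T)
    (h1 : (2 * j + 1) * T < 2 * π) (h2 : 2 * π < (2 * j + 2) * T)
    (x : ℝ) (hx0 : 0 ≤ x) (hx1 : x < 2 * π)
    (hB : ∀ m n : ℤ, x ≠ m * T + n * π) :
    (x : AddCircle (2 * Real.pi)) ∈ coveredSet T ((2 * j + 1) * T + π) := by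
  have hpi := Real.pi_pos
  have hjT : 0 ≤ (j : ℝ) * T := by positivity
  have main : ∀ (k : ℕ) (a : ℝ) (m : ℤ), k * T < a → a < (k + 1) * T →
      a < (2 * j + 1) * T + π → a = x + lam k + m * (2 * π) →
      (x : AddCircle (2 * Real.pi)) ∈ coveredSet T ((2 * j + 1) * T + π) := by
    intro k a m b1 b2 b3 b4
    simp only [coveredSet, mem_iUnion, mem_image, mem_Ioo, lt_min_iff]
    refine ⟨k, a, ⟨b1, b2, b3⟩, ?_⟩
    rw [← sub_eq_zero, ← AddCircle.coe_sub, AddCircle.coe_eq_zero_iff]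
    exact ⟨m, by rw [zsmul_eq_mul]; linarith⟩
  obtain ⟨i, hi⟩ : ∃ i : ℕ, i = ⌊x / T⌋₊ := ⟨_, rfl⟩
  have hi1 : i * T < x := by
    have : (i : ℝ) ≤ x / T := by rw [hi]; exact Nat.floor_le (by positivity)
    rw [le_div_iff₀ hT] at this
    refine lt_of_le_of_ne this fun h => hB i 0 ?_
    push_cast; linarith
  have hi2 : x < (i + 1) * T := by
    have : x / T < i + 1 := by rw [hi]; exact Nat.lt_floor_add_one _
    rwa [div_lt_iff₀ hT] at this
  have hiN : i ≤ 2 * j + 1 := by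
    have : (i : ℝ) < 2 * j + 2 :=
      lt_of_mul_lt_mul_right (hi1.trans (hx1.trans h2)) hT.le
    have : i < 2 * j + 2 := by exact_mod_cast this
    omega
  rcases Nat.even_or_odd i with hie | hio
  · have : i + 1 ≤ 2 * j + 1 := by
      rcases hie with ⟨r, hr⟩; omega
    have h3 : ((i : ℝ) + 1) ≤ 2 * j + 1 := by exact_mod_cast this
    have h4 := mul_le_mul_of_nonneg_right h3 hT.le
    exact main i x 0 hi1 hi2 (by linarith) (by simp [lam, hie])
  have hc : x ≠ (i + 1 + j) * T - π := by
    intro h; apply hB (i + 1 + j) (-1); push_cast; linarith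
  rcases lt_or_gt_of_ne hc with hlt | hgt
  · rcases le_or_gt i j with hij | hij
    · have h3 : (i : ℝ) ≤ j := by exact_mod_cast hij
      have h4 := mul_le_mul_of_nonneg_right h3 hT.le
      have hev : Even (i + (2 * j + 1)) := by
        rcases hio with ⟨r, hr⟩; exact ⟨r + j + 1, by omega⟩
      refine main (i + (2 * j + 1)) (x + 2 * π) 1 ?_ ?_ ?_ ?_
      · push_cast; linarith
      · push_cast; linarith
      · linarith
      · simp [lam, hev]
    · obtain ⟨d, hd⟩ : ∃ d, i = j + 1 + d := ⟨i - (j + 1), by omega⟩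
      have hod : ¬ Even d := by
        rw [Nat.not_even_iff_odd]
        rcases hio with ⟨r, hr⟩; rcases hjo with ⟨s, hs⟩
        exact ⟨r - s - 1, by omega⟩
      have hd' : (i : ℝ) = j + 1 + d := by exact_mod_cast hd
      rw [hd'] at hi1 hi2 hlt
      refine main d (x - π) (-1) ?_ ?_ ?_ ?_
      · linarith
      · linarith
      · linarith
      · simp [lam, hod]; ring
  · rcases Nat.lt_or_ge i (2 * j + 1) with hl | hg
    · have h3 : (i : ℝ) + 1 ≤ 2 * j + 1 := by exact_mod_cast hl
      have h4 := mul_le_mul_of_nonneg_right h3 hT.le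
      have hod : ¬ Even (j + i + 1) := by
        rw [Nat.not_even_iff_odd]
        rcases hio with ⟨r, hr⟩; rcases hjo with ⟨s, hs⟩
        exact ⟨r + s + 1, by omega⟩
      refine main (j + i + 1) (x + π) 0 ?_ ?_ ?_ ?_
      · push_cast; linarith
      · push_cast; linarith
      · linarith
      · simp [lam, hod]
    · have : i = 2 * j + 1 := by omega
      have h3 : (i : ℝ) = 2 * j + 1 := by exact_mod_cast this
      rw [h3] at hi1 hi2 hgt
      refine main j (x - π) (-1) ?_ ?_ ?_ ?_
      · linarith
      · linarith
      · linarith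
      · simp [lam, Nat.not_even_iff_odd.mpr hjo]; ring

theorem aux_countable (T : ℝ) : {x : ℝ | ∃ m n : ℤ, x = m * T + n * π}.Countable := by
  have : {x : ℝ | ∃ m n : ℤ, x = m * T + n * π} =
      Set.range (fun p : ℤ × ℤ => (p.1 : ℝ) * T + p.2 * π) := by
    ext x; constructor
    · rintro ⟨m, n, h⟩; exact ⟨(m, n), h.symm⟩
    · rintro ⟨p, h⟩; exact ⟨p.1, p.2, h.symm⟩
  rw [this]; exact Set.countable_range _

/-- Lemma 1.8 iv): T₀ ∈ (0,π), 2π/T₀ ∉ ℕ, N = ⌊2π/T₀⌋ and j = ⌊π/T₀⌋ both odd. Then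
the system is observable and T_opt = N·T₀ + π. -/
theorem stmt_15 (T0 : ℝ) (hT0 : T0 ∈ Set.Ioo 0 Real.pi)
    (hnotnat : ¬ ∃ m : ℕ, 2 * Real.pi / T0 = (m : ℝ))
    (N j : ℕ) (hN : N = ⌊2 * Real.pi / T0⌋₊) (hj : j = ⌊Real.pi / T0⌋₊)
    (hNo : Odd N) (hjo : Odd j) :
    { t : ℝ | 0 < t ∧ volume (coveredSet T0 t)ᶜ = 0 }.Nonempty ∧
      Topt T0 = (N : ℝ) * T0 + Real.pi := by
  obtain ⟨hT, hTpi⟩ := hT0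
  have hpi := Real.pi_pos
  have h0 : j * T0 ≤ π := by
    have : (j : ℝ) ≤ π / T0 := by rw [hj]; exact Nat.floor_le (by positivity)
    rwa [le_div_iff₀ hT] at this
  have h0' : π < (j + 1) * T0 := by
    have : π / T0 < j + 1 := by rw [hj]; exact Nat.lt_floor_add_one _
    rwa [div_lt_iff₀ hT] at this
  have hN1 : N * T0 < 2 * π := by
    have : (N : ℝ) ≤ 2 * π / T0 := by rw [hN]; exact Nat.floor_le (by positivity)
    have := lt_of_le_of_ne this fun h => hnotnat ⟨N, h.symm⟩
    rwa [lt_div_iff₀ hT] at this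
  have hN2 : 2 * π < (N + 1) * T0 := by
    have : 2 * π / T0 < N + 1 := by rw [hN]; exact Nat.lt_floor_add_one _
    rwa [div_lt_iff₀ hT] at this
  have hNj : N = 2 * j + 1 := by
    have e1 : (N : ℝ) < 2 * j + 2 := lt_of_mul_lt_mul_right (by linarith) hT.le
    have e2 : (2 * j : ℝ) < N + 1 := lt_of_mul_lt_mul_right (by linarith) hT.le
    have e1 : N < 2 * j + 2 := by exact_mod_cast e1
    have e2 : 2 * j < N + 1 := by exact_mod_cast e2
    rcases hNo with ⟨r, hr⟩
    omega
  clear hN hj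
  have hNr : (N : ℝ) = 2 * j + 1 := by exact_mod_cast hNj
  rw [hNr] at hN1 hN2 ⊢
  have h2 : 2 * π < (2 * j + 2) * T0 := by linarith
  have hleast : IsLeast { t : ℝ | 0 < t ∧ volume (coveredSet T0 t)ᶜ = 0 }
      ((2 * j + 1) * T0 + π) := by
    constructor
    · refine ⟨by positivity, ?_⟩
      have hc := (aux_countable T0).image (fun x : ℝ => (x : AddCircle (2 * π)))
      have hns : NullSingletonClass (volume : Measure (AddCircle (2 * π))) := by
        refine ⟨fun x => ?_⟩
        rw [← Metric.closedBall_zero, AddCircle.volume_closedBall]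
        simp [hpi.le]
      refine measure_mono_null ?_ (hc.measure_zero _)
      intro y hy
      obtain ⟨x, hx, rfl⟩ : ∃ x ∈ Ico (0 : ℝ) (0 + 2 * π), (x : AddCircle (2 * π)) = y := by
        have := AddCircle.coe_image_Ico_eq (2 * π) 0
        have hy' : y ∈ (Set.univ : Set (AddCircle (2 * π))) := trivial
        rw [← this] at hy'
        exact hy'
      by_contra hne
      apply hy
      refine aux_upper T0 j hT hjo h0 h0' hN1 h2 x hx.1 (by linarith [hx.2]) ?_
      intro m n h
      exact hne ⟨x, ⟨m, n, h⟩, rfl⟩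
    · rintro t ⟨ht0, ht⟩
      by_contra hlt
      push Not at hlt
      have hopen : IsOpen ((fun x : ℝ => (x : AddCircle (2 * π))) ''
          Ioo (max (j * T0) (t - 2 * π)) ((2 * j + 1) * T0 - π)) :=
        QuotientAddGroup.isOpenMap_coe _ isOpen_Ioo
      have hne : ((fun x : ℝ => (x : AddCircle (2 * π))) ''
          Ioo (max (j * T0) (t - 2 * π)) ((2 * j + 1) * T0 - π)).Nonempty := by
        refine Set.Nonempty.image _ (nonempty_Ioo.mpr (max_lt ?_ ?_)) <;> linarith
      refine (hopen.measure_pos volume hne).ne' (measure_mono_null ?_ ht)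
      rintro _ ⟨x, ⟨hx1, hx2⟩, rfl⟩
      rw [max_lt_iff] at hx1
      exact aux_lower T0 t j hT hjo hN1 h2 hlt x hx1.1 hx1.2 hx2
  exact ⟨⟨_, hleast.1⟩, hleast.csInf_eq⟩
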